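/- Let δ > 0, c > 0 and T ≥ 0. There is no twice differentiable function y : [0,∞) → ℝ such that y(t) > 0 and y″(t) ≥ 2δ for all t ≥ 0, and y(t)·y″(t) ≥ ((4+c)/4)·y′(t)² for all t ≥ T. -/

import Mathlib

theorem mul_sub_le_sub_of_hasDerivWithinAt_Ici {f f' : ℝ → ℝ} {a C : ℝ}
    (hf : ∀ t, a ≤ t → HasDerivWithinAt f (f' t) (Set.Ici a) t)
    (hC : ∀ t, a ≤ t → C ≤ f' t) {t : ℝ} (ht : a ≤ t) : C * (t - a) ≤ f t - f a := by
  have hg : ∀ s, a ≤ s → HasDerivWithinAt (fun s => f s - C * s) (f' s - C * 1) (Set.Ici a) s :=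
    fun s hs => (hf s hs).sub ((hasDerivWithinAt_id s _).const_mul C)
  have hmono : MonotoneOn (fun s => f s - C * s) (Set.Ici a) := by
    refine monotoneOn_of_hasDerivWithinAt_nonneg (f' := fun s => f' s - C * 1) (convex_Ici a)
      (fun s hs => (hg s hs).continuousWithinAt)
      (fun s hs => (hg s (interior_subset hs)).mono interior_subset) fun s hs => ?_
    have := hC s (interior_subset hs)
    linarith
  have := hmono (Set.mem_Ici.2 le_rfl) (Set.mem_Ici.2 ht) ht
  simp only at this
  linarith

/-- The quotient `y / y'` is eventually positive with derivative at most `-c / 4`, which is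
impossible on a half-line. -/
theorem stmt13 (δ c T : ℝ) (hδ : 0 < δ) (hc : 0 < c) (hT : 0 ≤ T) :
    ¬ ∃ (y y' y'' : ℝ → ℝ),
      (∀ t, 0 ≤ t → HasDerivWithinAt y (y' t) (Set.Ici 0) t) ∧
      (∀ t, 0 ≤ t → HasDerivWithinAt y' (y'' t) (Set.Ici 0) t) ∧
      (∀ t, 0 ≤ t → 0 < y t) ∧
      (∀ t, 0 ≤ t → 2 * δ ≤ y'' t) ∧
      (∀ t, T ≤ t → ((4 + c)/4) * (y' t)^2 ≤ y t * y'' t) := by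
  rintro ⟨y, y', y'', hy, hy', hpos, hconv, hineq⟩
  obtain ⟨S, hTS, hS⟩ : ∃ S, T ≤ S ∧ ∀ t, S ≤ t → 0 < y' t := by
    refine ⟨max T (|y' 0| / (2 * δ) + 1), le_max_left _ _, fun t ht => ?_⟩
    have h1 : |y' 0| / (2 * δ) < t := by linarith [le_max_right T (|y' 0| / (2 * δ) + 1)]
    have h2 := mul_sub_le_sub_of_hasDerivWithinAt_Ici hy' hconv
      (hT.trans ((le_max_left _ _).trans ht))
    rw [div_lt_iff₀ (by positivity)] at h1
    linarith [neg_abs_le (y' 0)]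
  have hS0 : 0 ≤ S := hT.trans hTS
  have hderiv : ∀ t, S ≤ t → HasDerivWithinAt (fun s => -(y s / y' s))
      (-((y' t * y' t - y t * y'' t) / y' t ^ 2)) (Set.Ici S) t := fun t ht =>
    (((hy t (hS0.trans ht)).div (hy' t (hS0.trans ht)) (hS t ht).ne').neg).mono
      (Set.Ici_subset_Ici.2 hS0)
  have hbound : ∀ t, S ≤ t → c / 4 ≤ -((y' t * y' t - y t * y'' t) / y' t ^ 2) := by
    intro t ht
    have := hS t ht
    rw [← neg_div, le_div_iff₀ (by positivity)]
    linarith [hineq t (hTS.trans ht)]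
  have hquot : ∀ t, S ≤ t → 0 < y t / y' t := fun t ht =>
    div_pos (hpos t (hS0.trans ht)) (hS t ht)
  have ht : S ≤ S + y S / y' S / (c / 4) := by
    have := hquot S le_rfl
    linarith [div_pos this (show 0 < c / 4 by positivity)]
  have h := mul_sub_le_sub_of_hasDerivWithinAt_Ici hderiv hbound ht
  rw [add_sub_cancel_left, mul_div_cancel₀ _ (by positivity : c / 4 ≠ 0)] at h
  linarith [hquot _ ht]
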